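/- A lightcone framed curve (γ,ℓ⁺,ℓ⁻) : I → ℝ³₁ × Δ₄ with lightcone curvature (κ₁,κ₂,κ₃,α,β) is an (nᵀ,n̄ᵀ)-Bertrand lightcone framed curve if and only if there exist smooth functions λ, θ : I → ℝ with λ ≢ 0 such that λ(t)(κ₂(t)+κ₃(t))·cos θ(t) − (α(t) − β(t) + λ(t)κ₁(t))·sin θ(t) = 0 for all t ∈ I. -/

import Mathlib

open Matrix

noncomputable section

/-- The Minkowski pseudo-scalar product on `ℝ³`:
`⟨x,y⟩ = −x₁y₁ + x₂y₂ + x₃y₃`. -/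
def mdot (x y : Fin 3 → ℝ) : ℝ := -(x 0 * y 0) + x 1 * y 1 + x 2 * y 2

/-- The pseudo vector product `x ∧ y` on Minkowski `ℝ³`, i.e. the determinant of the
matrix with rows `(−e₁, e₂, e₃)`, `x`, `y`. -/
def mcross (x y : Fin 3 → ℝ) : Fin 3 → ℝ :=
  ![-(x 1 * y 2 - x 2 * y 1), x 2 * y 0 - x 0 * y 2, x 0 * y 1 - x 1 * y 0]

/-- The (punctured) lightcone `LC* = {x ≠ 0 : ⟨x,x⟩ = 0}`. -/
def LCstar (x : Fin 3 → ℝ) : Prop := x ≠ 0 ∧ mdot x x = 0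

/-- Membership in `Δ₄ = {(v,w) ∈ LC* × LC* : ⟨v,w⟩ = −2}`. -/
def MemDelta4 (v w : Fin 3 → ℝ) : Prop := LCstar v ∧ LCstar w ∧ mdot v w = -2

/-- `n(t) = −(1/2) ℓ⁺(t) ∧ ℓ⁻(t)`. -/
def lcn (lp lm : ℝ → Fin 3 → ℝ) : ℝ → Fin 3 → ℝ :=
  fun t => (-(1/2) : ℝ) • mcross (lp t) (lm t)

/-- Smoothness (on `I`) of a real valued function. -/
def Smooth1 (I : Set ℝ) (f : ℝ → ℝ) : Prop := ContDiffOn ℝ (⊤ : ℕ∞) f I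

/-- Smoothness (on `I`) of an `ℝ³`-valued function. -/
def Smooth3 (I : Set ℝ) (f : ℝ → Fin 3 → ℝ) : Prop := ContDiffOn ℝ (⊤ : ℕ∞) f I

/-- `λ ≢ 0` : the set where `λ` is non-zero is dense in `I`. -/
def NotIdentZero (I : Set ℝ) (f : ℝ → ℝ) : Prop :=
  I ⊆ closure {t | t ∈ I ∧ f t ≠ 0}

/-- A lightcone framed curve `(γ, ℓ⁺, ℓ⁻) : I → ℝ³₁ × Δ₄`. -/
structure IsLightconeFramedCurve (I : Set ℝ) (γ lp lm : ℝ → Fin 3 → ℝ) : Prop where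
  smooth_base : Smooth3 I γ
  smooth_lp : Smooth3 I lp
  smooth_lm : Smooth3 I lm
  delta4 : ∀ t ∈ I, MemDelta4 (lp t) (lm t)
  exists_coeffs : ∃ α β : ℝ → ℝ, Smooth1 I α ∧ Smooth1 I β ∧
    ∀ t ∈ I, deriv γ t = α t • lp t + β t • lm t

/-- `(κ₁, κ₂, κ₃, α, β)` is the lightcone curvature of the lightcone framed curve
`(γ, ℓ⁺, ℓ⁻)`. -/
structure HasLightconeCurvature (I : Set ℝ) (γ lp lm : ℝ → Fin 3 → ℝ)
    (κ₁ κ₂ κ₃ α β : ℝ → ℝ) : Prop where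
  smooth_κ₁ : Smooth1 I κ₁
  smooth_κ₂ : Smooth1 I κ₂
  smooth_κ₃ : Smooth1 I κ₃
  smooth_α : Smooth1 I α
  smooth_β : Smooth1 I β
  deriv_lp : ∀ t ∈ I, deriv lp t = κ₁ t • lp t + (2 * κ₃ t) • lcn lp lm t
  deriv_lm : ∀ t ∈ I, deriv lm t = (-κ₁ t) • lm t + (2 * κ₂ t) • lcn lp lm t
  deriv_n : ∀ t ∈ I, deriv (lcn lp lm) t = κ₂ t • lp t + κ₃ t • lm t
  deriv_base : ∀ t ∈ I, deriv γ t = α t • lp t + β t • lm t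

/-- The vector field `ℓ⁺` built from a lightcone frame. -/
def fieldLp (lp lm : ℝ → Fin 3 → ℝ) : ℝ → Fin 3 → ℝ := fun t => lp t
/-- The vector field `ℓ⁻` built from a lightcone frame. -/
def fieldLm (lp lm : ℝ → Fin 3 → ℝ) : ℝ → Fin 3 → ℝ := fun t => lm t
/-- `nᵀ = (ℓ⁺ + ℓ⁻)/2`. -/
def fieldNT (lp lm : ℝ → Fin 3 → ℝ) : ℝ → Fin 3 → ℝ := fun t => (1/2 : ℝ) • (lp t + lm t)
/-- `nˢ = (ℓ⁺ − ℓ⁻)/2`. -/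
def fieldNS (lp lm : ℝ → Fin 3 → ℝ) : ℝ → Fin 3 → ℝ := fun t => (1/2 : ℝ) • (lp t - lm t)
/-- `n = −(1/2) ℓ⁺ ∧ ℓ⁻`. -/
def fieldN (lp lm : ℝ → Fin 3 → ℝ) : ℝ → Fin 3 → ℝ := lcn lp lm
/-- `ℓ̃⁺ = nᵀ + n`. -/
def fieldLtp (lp lm : ℝ → Fin 3 → ℝ) : ℝ → Fin 3 → ℝ :=
  fun t => fieldNT lp lm t + fieldN lp lm t
/-- `ℓ̃⁻ = nᵀ − n`. -/
def fieldLtm (lp lm : ℝ → Fin 3 → ℝ) : ℝ → Fin 3 → ℝ :=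
  fun t => fieldNT lp lm t - fieldN lp lm t

/-- `(γ,ℓ⁺,ℓ⁻)` and `(γ̄,ℓ̄⁺,ℓ̄⁻)` are `(v,w̄)`-mates. -/
def AreMates (I : Set ℝ)
    (v w : (ℝ → Fin 3 → ℝ) → (ℝ → Fin 3 → ℝ) → ℝ → Fin 3 → ℝ)
    (γ lp lm γ' lp' lm' : ℝ → Fin 3 → ℝ) : Prop :=
  IsLightconeFramedCurve I γ lp lm ∧ IsLightconeFramedCurve I γ' lp' lm' ∧
  ∃ lam : ℝ → ℝ, Smooth1 I lam ∧ NotIdentZero I lam ∧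
    (∀ t ∈ I, γ' t = γ t + lam t • v lp lm t) ∧
    (∀ t ∈ I, v lp lm t = w lp' lm' t)

/-- `(γ,ℓ⁺,ℓ⁻)` is a `(v,w̄)`-Bertrand lightcone framed curve. -/
def IsBertrand (I : Set ℝ)
    (v w : (ℝ → Fin 3 → ℝ) → (ℝ → Fin 3 → ℝ) → ℝ → Fin 3 → ℝ)
    (γ lp lm : ℝ → Fin 3 → ℝ) : Prop :=
  ∃ γ' lp' lm' : ℝ → Fin 3 → ℝ, AreMates I v w γ lp lm γ' lp' lm'

lemma mdot_add_left (x y z : Fin 3 → ℝ) : mdot (x + y) z = mdot x z + mdot y z := by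
  simp only [mdot, Pi.add_apply]; ring

lemma mdot_smul_left (c : ℝ) (x y : Fin 3 → ℝ) : mdot (c • x) y = c * mdot x y := by
  simp only [mdot, Pi.smul_apply, smul_eq_mul]; ring

lemma mdot_comm (x y : Fin 3 → ℝ) : mdot x y = mdot y x := by
  simp only [mdot]; ring

lemma mdot_add_right (x y z : Fin 3 → ℝ) : mdot x (y + z) = mdot x y + mdot x z := by
  simp only [mdot, Pi.add_apply]; ring

lemma mdot_smul_right (c : ℝ) (x y : Fin 3 → ℝ) : mdot x (c • y) = c * mdot x y := by
  simp only [mdot, Pi.smul_apply, smul_eq_mul]; ring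

lemma mdot_sub_left (x y z : Fin 3 → ℝ) : mdot (x - y) z = mdot x z - mdot y z := by
  simp only [mdot, Pi.sub_apply]; ring

lemma mdot_sub_right (x y z : Fin 3 → ℝ) : mdot x (y - z) = mdot x y - mdot x z := by
  simp only [mdot, Pi.sub_apply]; ring

lemma mdot_mcross_left (x y : Fin 3 → ℝ) : mdot x (mcross x y) = 0 := by
  simp [mdot, mcross]; ring

lemma mdot_mcross_right (x y : Fin 3 → ℝ) : mdot y (mcross x y) = 0 := by
  simp [mdot, mcross]; ring

/-- The Lorentzian Gram determinant identity: `⟨v, x ∧ y⟩²` is minus the Gram determinant. -/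
lemma mdot_mcross_sq (v x y : Fin 3 → ℝ) :
    mdot v (mcross x y) ^ 2 =
      -(mdot v v * (mdot x x * mdot y y - mdot x y ^ 2)
        - mdot v x * (mdot v x * mdot y y - mdot x y * mdot v y)
        + mdot v y * (mdot v x * mdot x y - mdot x x * mdot v y)) := by
  simp [mdot, mcross]; ring

lemma mdot_mcross_self (x y : Fin 3 → ℝ) :
    mdot (mcross x y) (mcross x y) = mdot x y ^ 2 - mdot x x * mdot y y := by
  simp [mdot, mcross]; ring

/-- The frame `(nᵀ, nˢ, n)` is pseudo-orthonormal. -/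
structure IsLorentzFrame (T S N : Fin 3 → ℝ) : Prop where
  TT : mdot T T = -1
  SS : mdot S S = 1
  NN : mdot N N = 1
  TS : mdot T S = 0
  TN : mdot T N = 0
  SN : mdot S N = 0

lemma MemDelta4.isLorentzFrame {lp lm : ℝ → Fin 3 → ℝ} {t : ℝ} (h : MemDelta4 (lp t) (lm t)) :
    IsLorentzFrame (fieldNT lp lm t) (fieldNS lp lm t) (lcn lp lm t) := by
  obtain ⟨⟨-, hp⟩, ⟨-, hm⟩, hpm⟩ := h
  have hmp := mdot_comm (lm t) (lp t)
  constructor <;>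
  simp only [fieldNT, fieldNS, lcn, mdot_add_left, mdot_add_right, mdot_sub_left, mdot_sub_right,
    mdot_smul_left, mdot_smul_right, mdot_mcross_left, mdot_mcross_right, mdot_mcross_self,
    hp, hm, hmp, hpm] <;> norm_num

/-- A unit spacelike vector orthogonal to `nᵀ` has unit coordinates with respect to `nˢ, n`. -/
lemma MemDelta4.sq_add_sq_eq_one {lp lm : ℝ → Fin 3 → ℝ} {t : ℝ} (h : MemDelta4 (lp t) (lm t))
    {v : Fin 3 → ℝ} (hv : mdot v v = 1) (hvT : mdot v (fieldNT lp lm t) = 0) :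
    mdot v (fieldNS lp lm t) ^ 2 + mdot v (lcn lp lm t) ^ 2 = 1 := by
  obtain ⟨⟨-, hp⟩, ⟨-, hm⟩, hpm⟩ := h
  have hg := mdot_mcross_sq v (lp t) (lm t)
  rw [hp, hm, hpm, hv] at hg
  simp only [fieldNT, fieldNS, lcn, mdot_add_right, mdot_sub_right, mdot_smul_right] at hvT ⊢
  linear_combination (1 / 4) * hg + (1 / 2) * (mdot v (lp t) + mdot v (lm t)) * hvT

lemma memDelta4_of_isLorentzFrame {T S N : Fin 3 → ℝ} (h : IsLorentzFrame T S N) (c s : ℝ)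
    (hcs : c ^ 2 + s ^ 2 = 1) :
    MemDelta4 (T + (c • S + s • N)) (T - (c • S + s • N)) := by
  have hST := mdot_comm S T
  have hNT := mdot_comm N T
  have hNS := mdot_comm N S
  rw [h.TS] at hST
  rw [h.TN] at hNT
  rw [h.SN] at hNS
  have hpm : mdot (T + (c • S + s • N)) (T - (c • S + s • N)) = -2 := by
    simp only [mdot_add_left, mdot_add_right, mdot_sub_right,
      mdot_smul_left, mdot_smul_right, h.TT, h.SS, h.NN, h.TS, h.TN, h.SN, hST, hNT, hNS]
    linear_combination -hcs
  refine ⟨⟨?_, ?_⟩, ⟨?_, ?_⟩, hpm⟩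
  · intro h0
    rw [h0] at hpm
    simp [mdot] at hpm
  · simp only [mdot_add_left, mdot_add_right,
      mdot_smul_left, mdot_smul_right, h.TT, h.SS, h.NN, h.TS, h.TN, h.SN, hST, hNT, hNS]
    linear_combination hcs
  · intro h0
    rw [h0] at hpm
    simp [mdot] at hpm
  · simp only [mdot_add_left, mdot_add_right, mdot_sub_left, mdot_sub_right,
      mdot_smul_left, mdot_smul_right, h.TT, h.SS, h.NN, h.TS, h.TN, h.SN, hST, hNT, hNS]
    linear_combination hcs

lemma Smooth3.mdot {I : Set ℝ} {f g : ℝ → Fin 3 → ℝ} (hf : Smooth3 I f) (hg : Smooth3 I g) :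
    Smooth1 I (fun t => mdot (f t) (g t)) := by
  have hf' := contDiffOn_pi.1 hf
  have hg' := contDiffOn_pi.1 hg
  exact ((((hf' 0).mul (hg' 0)).neg).add ((hf' 1).mul (hg' 1))).add ((hf' 2).mul (hg' 2))

lemma Smooth3.lcn {I : Set ℝ} {f g : ℝ → Fin 3 → ℝ} (hf : Smooth3 I f) (hg : Smooth3 I g) :
    Smooth3 I (lcn f g) := by
  have hf' := contDiffOn_pi.1 hf
  have hg' := contDiffOn_pi.1 hg
  refine ContDiffOn.const_smul _ (contDiffOn_pi.2 fun i => ?_)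
  fin_cases i
  · exact (((hf' 1).mul (hg' 2)).sub ((hf' 2).mul (hg' 1))).neg
  · exact ((hf' 2).mul (hg' 0)).sub ((hf' 0).mul (hg' 2))
  · exact ((hf' 0).mul (hg' 1)).sub ((hf' 1).mul (hg' 0))

lemma Smooth3.fieldNT {I : Set ℝ} {f g : ℝ → Fin 3 → ℝ} (hf : Smooth3 I f) (hg : Smooth3 I g) :
    Smooth3 I (fieldNT f g) :=
  ContDiffOn.const_smul _ (ContDiffOn.add hf hg)

lemma Smooth3.fieldNS {I : Set ℝ} {f g : ℝ → Fin 3 → ℝ} (hf : Smooth3 I f) (hg : Smooth3 I g) :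
    Smooth3 I (fieldNS f g) :=
  ContDiffOn.const_smul _ (ContDiffOn.sub hf hg)

lemma ContDiffOn.hasDerivAt_of_isOpen {E : Type*} [NormedAddCommGroup E] [NormedSpace ℝ E]
    {I : Set ℝ} (hI : IsOpen I) {f : ℝ → E} (hf : ContDiffOn ℝ (⊤ : ℕ∞) f I) {t : ℝ}
    (ht : t ∈ I) : HasDerivAt f (deriv f t) t :=
  ((hf.contDiffAt (hI.mem_nhds ht)).differentiableAt (by simp)).hasDerivAt

/-- A smooth function on an open interval has a smooth primitive there. -/
lemma exists_smooth_primitive {I : Set ℝ} (hIo : IsOpen I) (hIc : I.OrdConnected)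
    {f : ℝ → ℝ} (hf : Smooth1 I f) {t₀ : ℝ} (ht₀ : t₀ ∈ I) (c : ℝ) :
    ∃ F : ℝ → ℝ, Smooth1 I F ∧ F t₀ = c ∧ ∀ t ∈ I, HasDerivAt F (f t) t := by
  have hd : ∀ t ∈ I, HasDerivAt (fun t => c + ∫ x in t₀..t, f x) (f t) t := by
    intro t ht
    refine HasDerivAt.const_add c ?_
    refine intervalIntegral.integral_hasDerivAt_right ?_ ?_ ?_
    · exact (hf.continuousOn.mono (hIc.uIcc_subset ht₀ ht)).intervalIntegrable
    · exact hf.continuousOn.stronglyMeasurableAtFilter hIo t ht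
    · exact hf.continuousOn.continuousAt (hIo.mem_nhds ht)
  refine ⟨_, ?_, by simp, hd⟩
  refine (contDiffOn_infty_iff_deriv_of_isOpen hIo).2
    ⟨fun t ht => (hd t ht).differentiableAt.differentiableWithinAt, ?_⟩
  exact hf.congr fun t ht => (hd t ht).deriv

/-- A smooth curve in the unit circle over an open interval has a smooth angle function. -/
lemma exists_smooth_angle {I : Set ℝ} (hIo : IsOpen I) (hIc : I.OrdConnected)
    {a b : ℝ → ℝ} (ha : Smooth1 I a) (hb : Smooth1 I b)
    (hab : ∀ t ∈ I, a t ^ 2 + b t ^ 2 = 1) :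
    ∃ θ : ℝ → ℝ, Smooth1 I θ ∧ ∀ t ∈ I, a t = Real.cos (θ t) ∧ b t = Real.sin (θ t) := by
  rcases I.eq_empty_or_nonempty with rfl | ⟨t₀, ht₀⟩
  · exact ⟨0, contDiffOn_const, by simp⟩
  have ha' : Smooth1 I (deriv a) := ((contDiffOn_infty_iff_deriv_of_isOpen hIo).1 ha).2
  have hb' : Smooth1 I (deriv b) := ((contDiffOn_infty_iff_deriv_of_isOpen hIo).1 hb).2
  obtain ⟨c, hc₁, hc₂⟩ : ∃ c : ℝ, a t₀ = Real.cos c ∧ b t₀ = Real.sin c := by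
    have hn : ‖(⟨a t₀, b t₀⟩ : ℂ)‖ = 1 := by
      rw [Complex.norm_eq_sqrt_sq_add_sq, hab t₀ ht₀, Real.sqrt_one]
    have h0 : (⟨a t₀, b t₀⟩ : ℂ) ≠ 0 := fun h => by simp [h] at hn
    exact ⟨Complex.arg ⟨a t₀, b t₀⟩, by rw [Complex.cos_arg h0, hn, div_one],
      by rw [Complex.sin_arg, hn, div_one]⟩
  obtain ⟨θ, hθ, hθ₀, hθd⟩ := exists_smooth_primitive hIo hIc
    (f := fun t => a t * deriv b t - b t * deriv a t)
    ((ha.mul hb').sub (hb.mul ha')) ht₀ c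
  have hda := fun t (ht : t ∈ I) => ContDiffOn.hasDerivAt_of_isOpen hIo ha ht
  have hdb := fun t (ht : t ∈ I) => ContDiffOn.hasDerivAt_of_isOpen hIo hb ht
  have horth : ∀ t ∈ I, a t * deriv a t + b t * deriv b t = 0 := by
    intro t ht
    have h1 := ((hda t ht).pow 2).add ((hdb t ht).pow 2)
    have h2 : HasDerivAt (a ^ 2 + b ^ 2) 0 t :=
      (hasDerivAt_const t (1 : ℝ)).congr_of_eventuallyEq
        (Filter.eventuallyEq_of_mem (hIo.mem_nhds ht) hab)
    have h3 := h1.unique h2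
    norm_num at h3
    linarith
  have hpre : IsPreconnected I := hIc.isPreconnected
  have hu : ∀ t ∈ I, HasDerivAt (fun t => a t * Real.cos (θ t) + b t * Real.sin (θ t)) 0 t := by
    intro t ht
    refine (((hda t ht).mul (hθd t ht).cos).add ((hdb t ht).mul (hθd t ht).sin)).congr_deriv ?_
    linear_combination -(Real.cos (θ t) * deriv a t + Real.sin (θ t) * deriv b t) * hab t ht
      + (Real.cos (θ t) * a t + Real.sin (θ t) * b t) * horth t ht
  have hw : ∀ t ∈ I, HasDerivAt (fun t => b t * Real.cos (θ t) - a t * Real.sin (θ t)) 0 t := by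
    intro t ht
    refine (((hdb t ht).mul (hθd t ht).cos).sub ((hda t ht).mul (hθd t ht).sin)).congr_deriv ?_
    linear_combination -(Real.cos (θ t) * deriv b t - Real.sin (θ t) * deriv a t) * hab t ht
      + (Real.cos (θ t) * b t - Real.sin (θ t) * a t) * horth t ht
  have hconst : ∀ f : ℝ → ℝ, (∀ t ∈ I, HasDerivAt f 0 t) → ∀ t ∈ I, f t = f t₀ :=
    fun f hf t ht => hIo.is_const_of_deriv_eq_zero hpre
      (fun s hs => (hf s hs).differentiableAt.differentiableWithinAt)
      (fun s hs => (hf s hs).deriv) ht ht₀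
  refine ⟨θ, hθ, fun t ht => ?_⟩
  have e1 := hconst _ hu t ht
  have e2 := hconst _ hw t ht
  simp only [hθ₀, hc₁, hc₂] at e1 e2
  have hc := Real.sin_sq_add_cos_sq c
  have ht' := Real.sin_sq_add_cos_sq (θ t)
  constructor
  · linear_combination Real.cos (θ t) * e1 - Real.sin (θ t) * e2 - a t * ht' + Real.cos (θ t) * hc
  · linear_combination Real.sin (θ t) * e1 + Real.cos (θ t) * e2 - b t * ht' + Real.sin (θ t) * hc

/-- The derivative of `γ + λ nᵀ` in the frame `(nᵀ, nˢ, n)`. -/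
lemma HasLightconeCurvature.hasDerivAt_add_smul_fieldNT {I : Set ℝ} (hIo : IsOpen I)
    {γ lp lm : ℝ → Fin 3 → ℝ} {κ₁ κ₂ κ₃ α β lam : ℝ → ℝ}
    (hF : IsLightconeFramedCurve I γ lp lm)
    (hC : HasLightconeCurvature I γ lp lm κ₁ κ₂ κ₃ α β) (hlam : Smooth1 I lam)
    {t : ℝ} (ht : t ∈ I) :
    HasDerivAt (fun t => γ t + lam t • fieldNT lp lm t)
      ((α t + β t + deriv lam t) • fieldNT lp lm t
        + (α t - β t + lam t * κ₁ t) • fieldNS lp lm t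
        + (lam t * (κ₂ t + κ₃ t)) • lcn lp lm t) t := by
  have hγ := ContDiffOn.hasDerivAt_of_isOpen hIo hF.smooth_base ht
  have hp := ContDiffOn.hasDerivAt_of_isOpen hIo hF.smooth_lp ht
  have hm := ContDiffOn.hasDerivAt_of_isOpen hIo hF.smooth_lm ht
  have hl := ContDiffOn.hasDerivAt_of_isOpen hIo hlam ht
  rw [hC.deriv_base t ht] at hγ
  rw [hC.deriv_lp t ht] at hp
  rw [hC.deriv_lm t ht] at hm
  refine (hγ.add (hl.smul ((hp.add hm).const_smul (1 / 2 : ℝ)))).congr_deriv ?_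
  simp only [fieldNT, fieldNS, Pi.smul_apply, Pi.add_apply]
  module

/-- `(nᵀ,n̄ᵀ)`-Bertrand lightcone framed curves: existence condition. -/
theorem bertrand_nT_nTbar
    (I : Set ℝ) (hIo : IsOpen I) (hIc : I.OrdConnected)
    (γ lp lm : ℝ → Fin 3 → ℝ) (κ₁ κ₂ κ₃ α β : ℝ → ℝ)
    (hF : IsLightconeFramedCurve I γ lp lm)
    (hC : HasLightconeCurvature I γ lp lm κ₁ κ₂ κ₃ α β) :
    IsBertrand I fieldNT fieldNT γ lp lm ↔
      ∃ lam θ : ℝ → ℝ, Smooth1 I lam ∧ Smooth1 I θ ∧ NotIdentZero I lam ∧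
        ∀ t ∈ I, lam t * (κ₂ t + κ₃ t) * Real.cos (θ t) -
          (α t - β t + lam t * κ₁ t) * Real.sin (θ t) = 0 := by
  constructor
  · rintro ⟨γ', lp', lm', -, hF', lam, hlam, hlam0, hγ', hT⟩
    obtain ⟨α', β', -, -, hαβ'⟩ := hF'.exists_coeffs
    have hS' := hF'.smooth_lp.fieldNS hF'.smooth_lm
    obtain ⟨θ, hθ, hcs⟩ := exists_smooth_angle hIo hIc
      (hS'.mdot (hF.smooth_lp.fieldNS hF.smooth_lm)) (hS'.mdot (hF.smooth_lp.lcn hF.smooth_lm))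
      (fun t ht => (hF.delta4 t ht).sq_add_sq_eq_one (hF'.delta4 t ht).isLorentzFrame.SS
        (by rw [hT t ht, mdot_comm]; exact (hF'.delta4 t ht).isLorentzFrame.TS))
    refine ⟨lam, θ, hlam, hθ, hlam0, fun t ht => ?_⟩
    rw [← (hcs t ht).1, ← (hcs t ht).2]
    have hd := (hC.hasDerivAt_add_smul_fieldNT hIo hF hlam ht).congr_of_eventuallyEq
      (Filter.eventuallyEq_of_mem (hIo.mem_nhds ht) hγ')
    have he : (α t + β t + deriv lam t) • fieldNT lp lm t
        + (α t - β t + lam t * κ₁ t) • fieldNS lp lm t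
        + (lam t * (κ₂ t + κ₃ t)) • lcn lp lm t
        = (α' t + β' t) • fieldNT lp lm t + (α' t - β' t) • fieldNS lp' lm' t := by
      rw [← hd.deriv, hαβ' t ht, hT t ht]
      simp only [fieldNT, fieldNS]
      module
    have hL := (hF.delta4 t ht).isLorentzFrame
    have hNS := mdot_comm (lcn lp lm t) (fieldNS lp lm t)
    have e1 := congrArg (fun x => mdot x (fieldNS lp lm t)) he
    have e2 := congrArg (fun x => mdot x (lcn lp lm t)) he
    simp only [mdot_add_left, mdot_smul_left, hL.TS, hL.TN, hL.SS, hL.NN, hNS, hL.SN] at e1 e2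
    linear_combination mdot (fieldNS lp' lm' t) (fieldNS lp lm t) * e2
      - mdot (fieldNS lp' lm' t) (lcn lp lm t) * e1
  · rintro ⟨lam, θ, hlam, hθ, hlam0, h⟩
    have hTs := hF.smooth_lp.fieldNT hF.smooth_lm
    have hc : Smooth1 I (fun t => Real.cos (θ t)) := Real.contDiff_cos.comp_contDiffOn hθ
    have hs : Smooth1 I (fun t => Real.sin (θ t)) := Real.contDiff_sin.comp_contDiffOn hθ
    have hlam' : Smooth1 I (deriv lam) := ((contDiffOn_infty_iff_deriv_of_isOpen hIo).1 hlam).2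
    have hR : Smooth3 I (fun t => Real.cos (θ t) • fieldNS lp lm t + Real.sin (θ t) • lcn lp lm t) :=
      (hc.smul (hF.smooth_lp.fieldNS hF.smooth_lm)).add (hs.smul (hF.smooth_lp.lcn hF.smooth_lm))
    have hA : Smooth1 I (fun t => α t + β t + deriv lam t) :=
      (hC.smooth_α.add hC.smooth_β).add hlam'
    have hB : Smooth1 I (fun t => (α t - β t + lam t * κ₁ t) * Real.cos (θ t)
        + lam t * (κ₂ t + κ₃ t) * Real.sin (θ t)) :=
      (((hC.smooth_α.sub hC.smooth_β).add (hlam.mul hC.smooth_κ₁)).mul hc).add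
        ((hlam.mul (hC.smooth_κ₂.add hC.smooth_κ₃)).mul hs)
    refine ⟨fun t => γ t + lam t • fieldNT lp lm t,
      fun t => fieldNT lp lm t + (Real.cos (θ t) • fieldNS lp lm t + Real.sin (θ t) • lcn lp lm t),
      fun t => fieldNT lp lm t - (Real.cos (θ t) • fieldNS lp lm t + Real.sin (θ t) • lcn lp lm t),
      hF, ⟨hF.smooth_base.add (hlam.smul hTs), hTs.add hR, hTs.sub hR, fun t ht =>
        memDelta4_of_isLorentzFrame (hF.delta4 t ht).isLorentzFrame _ _ (Real.cos_sq_add_sin_sq _),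
        ⟨_, _, (hA.add hB).mul (contDiffOn_const (c := 1 / 2)),
          (hA.sub hB).mul (contDiffOn_const (c := 1 / 2)), fun t ht => ?_⟩⟩,
      lam, hlam, hlam0, fun t _ => rfl, fun t _ => ?_⟩
    · rw [(hC.hasDerivAt_add_smul_fieldNT hIo hF hlam ht).deriv]
      have hcs := Real.cos_sq_add_sin_sq (θ t)
      have hp : α t - β t + lam t * κ₁ t = ((α t - β t + lam t * κ₁ t) * Real.cos (θ t)
          + lam t * (κ₂ t + κ₃ t) * Real.sin (θ t)) * Real.cos (θ t) := by
        linear_combination -(α t - β t + lam t * κ₁ t) * hcs - Real.sin (θ t) * h t ht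
      have hq : lam t * (κ₂ t + κ₃ t) = ((α t - β t + lam t * κ₁ t) * Real.cos (θ t)
          + lam t * (κ₂ t + κ₃ t) * Real.sin (θ t)) * Real.sin (θ t) := by
        linear_combination -(lam t * (κ₂ t + κ₃ t)) * hcs + Real.cos (θ t) * h t ht
      set B := (α t - β t + lam t * κ₁ t) * Real.cos (θ t)
          + lam t * (κ₂ t + κ₃ t) * Real.sin (θ t)
      rw [hp, hq]
      module
    · simp only [fieldNT]
      module
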